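/- Let M be a spacelike surface in ℝ^{3,1} with a canonical normal null direction Z. Then the curvature tensor R of M and the normal curvature tensor R^⊥ satisfy R(Z^⊤,W)Z^⊤ = (−Z^⊤(a) − a²) W and R^⊥(Z^⊤,W)Z^⊥ = −a B(Z^⊤,W), where Z^⊤(a) denotes the derivative of the function a in the direction Z^⊤. -/

import Mathlib

noncomputable section

/-- Points of the parameter domain of the surface chart. -/
abbrev Pt : Type := ℝ × ℝ

/-- Vectors of the Minkowski space `ℝ^{3,1}`. -/
abbrev E4 : Type := Fin 4 → ℝ

/-- The Minkowski bilinear form of signature `(+,+,+,-)` on `ℝ⁴`. -/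
def mink (v w : E4) : ℝ := v 0 * w 0 + v 1 * w 1 + v 2 * w 2 - v 3 * w 3

/-- Realization in `ℝ^{3,1}` of a coordinate vector field `X` along the immersion `ψ`. -/
def vecF (ψ : Pt → E4) (X : Pt → Pt) : Pt → E4 := fun p => fderiv ℝ ψ p (X p)

/-- Flat (ambient) derivative of an `ℝ⁴`-valued field along a coordinate vector field. -/
def Dflat (X : Pt → Pt) (V : Pt → E4) : Pt → E4 := fun p => fderiv ℝ V p (X p)

/-- Second fundamental form `B(X,Y) = ∇̄_X Y − ∇_X Y`. -/
def sff (ψ : Pt → E4) (conn : (Pt → Pt) → (Pt → Pt) → Pt → Pt) (X Y : Pt → Pt) : Pt → E4 :=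
  fun p => Dflat X (vecF ψ Y) p - vecF ψ (conn X Y) p

/-- `v` is tangent to the surface at `p`. -/
def isTangentV (ψ : Pt → E4) (p : Pt) (v : E4) : Prop := ∃ w : Pt, fderiv ℝ ψ p w = v

/-- `v` is normal to the surface at `p`. -/
def isNormalV (ψ : Pt → E4) (p : Pt) (v : E4) : Prop := ∀ w : Pt, mink v (fderiv ℝ ψ p w) = 0

/-- Lie bracket of coordinate vector fields on the chart. -/
def lieB (X Y : Pt → Pt) : Pt → Pt := fun p => fderiv ℝ Y p (X p) - fderiv ℝ X p (Y p)

/-- Curvature tensor `R(X,Y)V = ∇_Y∇_X V − ∇_X∇_Y V + ∇_{[X,Y]}V`. -/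
def curvR (conn : (Pt → Pt) → (Pt → Pt) → Pt → Pt) (X Y V : Pt → Pt) : Pt → Pt :=
  fun p => conn Y (conn X V) p - conn X (conn Y V) p + conn (lieB X Y) V p

/-- Normal curvature tensor `R^⊥(X,Y)ν = ∇⊥_Y∇⊥_X ν − ∇⊥_X∇⊥_Y ν + ∇⊥_{[X,Y]}ν`. -/
def curvRperp (nconn : (Pt → Pt) → (Pt → E4) → Pt → E4) (X Y : Pt → Pt) (ν : Pt → E4) :
    Pt → E4 :=
  fun p => nconn Y (nconn X ν) p - nconn X (nconn Y ν) p + nconn (lieB X Y) ν p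

/-- Determinant of four vectors of `ℝ⁴` (the volume form `e₁∧e₂∧e₃∧e₄ ↦ 1`). -/
def det4 (a b c d : E4) : ℝ := Matrix.det (Matrix.of ![a, b, c, d])

/-- A spacelike surface in `ℝ^{3,1}`, given by a chart `ψ : U → ℝ^{3,1}`, endowed with a
canonical normal null direction with respect to the constant unit spacelike vector `Z`,
together with all the associated geometric data: the Levi-Civita connection `conn`,
the normal connection `nconn`, the tangent part `Z^⊤` (coordinates `ZT`), the oriented
orthonormal completion `W` (coordinates `Wc`), the shape operator `shA = A_{Z^⊥}`,
the 1-form `β` with `B(X,Z^⊤) = β(X)Z^⊥`, and the lightlike normal field `W'` with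
`⟨Z^⊥,W'⟩ = 1`.  Each piece of data is characterized by its defining property. -/
structure CNND where
  U : Set Pt
  hUopen : IsOpen U
  ψ : Pt → E4
  hψ : ContDiffOn ℝ (⊤ : ℕ∞) ψ U
  himm : ∀ p ∈ U, ∀ v : Pt, fderiv ℝ ψ p v = 0 → v = 0
  hspacelike : ∀ p ∈ U, ∀ v : Pt, v ≠ 0 → 0 < mink (fderiv ℝ ψ p v) (fderiv ℝ ψ p v)
  /-- Levi-Civita connection of the induced metric, as the tangent part of the flat one. -/
  conn : (Pt → Pt) → (Pt → Pt) → Pt → Pt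
  hconn : ∀ X Y, ∀ p ∈ U, DifferentiableAt ℝ (vecF ψ Y) p → isNormalV ψ p (sff ψ conn X Y p)
  hconnSmooth : ∀ X Y, ContDiffOn ℝ (⊤ : ℕ∞) X U → ContDiffOn ℝ (⊤ : ℕ∞) Y U → ContDiffOn ℝ (⊤ : ℕ∞) (conn X Y) U
  /-- Normal connection: the normal part of the flat derivative of a normal field. -/
  nconn : (Pt → Pt) → (Pt → E4) → Pt → E4
  hnconn : ∀ X ν, ∀ p ∈ U, (∀ q ∈ U, isNormalV ψ q (ν q)) → DifferentiableAt ℝ ν p →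
    isNormalV ψ p (nconn X ν p) ∧ isTangentV ψ p (Dflat X ν p - nconn X ν p)
  hnconnSmooth : ∀ X ν, ContDiffOn ℝ (⊤ : ℕ∞) X U → (∀ q ∈ U, isNormalV ψ q (ν q)) →
    ContDiffOn ℝ (⊤ : ℕ∞) ν U → ContDiffOn ℝ (⊤ : ℕ∞) (nconn X ν) U
  /-- The parallel (constant) vector field `Z`, a unit spacelike vector. -/
  Z : E4
  hZunit : mink Z Z = 1
  /-- Coordinates of the tangent part `Z^⊤` of `Z`; `Z^⊥ = Z − Z^⊤` is normal. -/
  ZT : Pt → Pt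
  hZTsmooth : ContDiffOn ℝ (⊤ : ℕ∞) ZT U
  hZTtangentpart : ∀ p ∈ U, isNormalV ψ p (Z - fderiv ℝ ψ p (ZT p))
  /-- canonical normal null direction: `Z^⊥` is lightlike … -/
  hZperpNull : ∀ p ∈ U, mink (Z - fderiv ℝ ψ p (ZT p)) (Z - fderiv ℝ ψ p (ZT p)) = 0
  /-- … and nowhere zero. -/
  hZperpNe : ∀ p ∈ U, Z - fderiv ℝ ψ p (ZT p) ≠ 0
  /-- Coordinates of the unit tangent field `W` orthogonal to `Z^⊤`, positively oriented. -/
  Wc : Pt → Pt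
  hWsmooth : ContDiffOn ℝ (⊤ : ℕ∞) Wc U
  hWunit : ∀ p ∈ U, mink (fderiv ℝ ψ p (Wc p)) (fderiv ℝ ψ p (Wc p)) = 1
  hWorth : ∀ p ∈ U, mink (fderiv ℝ ψ p (ZT p)) (fderiv ℝ ψ p (Wc p)) = 0
  hWorient : ∀ p ∈ U, 0 < (ZT p).1 * (Wc p).2 - (ZT p).2 * (Wc p).1
  /-- The shape operator `A_{Z^⊥}`: `⟨A_{Z^⊥}X, Y⟩ = ⟨B(X,Y), Z^⊥⟩`. -/
  shA : (Pt → Pt) → Pt → Pt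
  hshA : ∀ X Y, ∀ p ∈ U, DifferentiableAt ℝ (vecF ψ Y) p →
    mink (fderiv ℝ ψ p (shA X p)) (fderiv ℝ ψ p (Y p)) =
      mink (sff ψ conn X Y p) (Z - fderiv ℝ ψ p (ZT p))
  /-- The 1-form `β` with `B(X, Z^⊤) = β(X) Z^⊥`. -/
  beta : Pt → Pt → ℝ
  hbeta : ∀ X, ∀ p ∈ U, sff ψ conn X ZT p = beta p (X p) • (Z - fderiv ℝ ψ p (ZT p))
  /-- The lightlike normal field `W'` with `⟨Z^⊥, W'⟩ = 1`, such that
  `(Z^⊤, W, (Z^⊥+W')/√2, (Z^⊥−W')/√2)` is a positively oriented orthonormal frame. -/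
  Wp : Pt → E4
  hWpNormal : ∀ p ∈ U, isNormalV ψ p (Wp p)
  hWpNull : ∀ p ∈ U, mink (Wp p) (Wp p) = 0
  hWpPair : ∀ p ∈ U, mink (Z - fderiv ℝ ψ p (ZT p)) (Wp p) = 1
  hWpOrient : ∀ p ∈ U, 0 < det4 (fderiv ℝ ψ p (ZT p)) (fderiv ℝ ψ p (Wc p))
    ((Real.sqrt 2)⁻¹ • ((Z - fderiv ℝ ψ p (ZT p)) + Wp p))
    ((Real.sqrt 2)⁻¹ • ((Z - fderiv ℝ ψ p (ZT p)) - Wp p))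

namespace CNND

variable (S : CNND)

/-- The normal part `Z^⊥` of `Z` along the surface. -/
def Zperp : Pt → E4 := fun p => S.Z - fderiv ℝ S.ψ p (S.ZT p)

/-- The second fundamental form of the surface. -/
def B : (Pt → Pt) → (Pt → Pt) → Pt → E4 := sff S.ψ S.conn

/-- The function `a = α(W) = ⟨B(W,W), Z^⊥⟩`. -/
def afun : Pt → ℝ := fun p => mink (S.B S.Wc S.Wc p) (S.Zperp p)

/-- The 1-form `α(X) = ⟨B(X,W), Z^⊥⟩`. -/
def alphaF (X : Pt → Pt) : Pt → ℝ := fun p => mink (S.B X S.Wc p) (S.Zperp p)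

/-- The mean curvature vector `H⃗ = (1/2)(B(Z^⊤,Z^⊤) + B(W,W))`. -/
def Hvec : Pt → E4 := fun p => (1 / 2 : ℝ) • (S.B S.ZT S.ZT p + S.B S.Wc S.Wc p)

/-- The Gauss curvature `K = ⟨R(Z^⊤,W)Z^⊤, W⟩`. -/
def Kfun : Pt → ℝ := fun p =>
  mink (fderiv ℝ S.ψ p (curvR S.conn S.ZT S.Wc S.ZT p)) (fderiv ℝ S.ψ p (S.Wc p))

/-- The normal curvature `K_N = ⟨R^⊥(Z^⊤,W)Z^⊥, W'⟩`. -/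
def KNfun : Pt → ℝ := fun p => mink (curvRperp S.nconn S.ZT S.Wc S.Zperp p) (S.Wp p)

end CNND

/-- The wedge `v ∧ w` of two vectors of `ℝ⁴`, as an antisymmetric matrix (bivector). -/
def wedge2 (v w : E4) : Fin 4 → Fin 4 → ℝ := fun i j => v i * w j - v j * w i

/-- The Gauss map `G = Z^⊤ ∧ W : M → Λ²ℝ^{3,1}`. -/
def CNND.Gmap (S : CNND) : Pt → Fin 4 → Fin 4 → ℝ :=
  fun p => wedge2 (fderiv ℝ S.ψ p (S.ZT p)) (fderiv ℝ S.ψ p (S.Wc p))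

/-- The signs of the Minkowski metric. -/
def epsM : Fin 4 → ℝ := fun i => if i = 3 then -1 else 1

/-- The induced (signature `(3,3)`) inner product on bivectors of `ℝ^{3,1}`:
`⟨v∧w, v'∧w'⟩ = ⟨v,v'⟩⟨w,w'⟩ − ⟨v,w'⟩⟨w,v'⟩`. -/
def binner (η η' : Fin 4 → Fin 4 → ℝ) : ℝ :=
  (1 / 2) * ∑ i : Fin 4, ∑ j : Fin 4, epsM i * epsM j * η i j * η' i j

/-- The wedge product `Λ²ℝ^{3,1} × Λ²ℝ^{3,1} → Λ⁴ℝ^{3,1} ≅ ℝ`, normalized so that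
`(v∧w)∧(v'∧w') = det(v,w,v',w')`. -/
def bwedge (η η' : Fin 4 → Fin 4 → ℝ) : ℝ :=
  (1 / 4) * ∑ σ : Equiv.Perm (Fin 4),
    ((Equiv.Perm.sign σ : ℤ) : ℝ) * η (σ 0) (σ 1) * η' (σ 2) (σ 3)

/-- The `ℂ`-bilinear form `H(η,η') = ⟨η,η'⟩ + i η∧η'` on bivectors, where `i = −⋆`. -/
def HformC (η η' : Fin 4 → Fin 4 → ℝ) : ℂ :=
  (binner η η' : ℝ) + (bwedge η η' : ℝ) * Complex.I

/-- The quadratic form `δ(u) = dG(u) ∧ dG(u)` whose zero directions are the asymptotic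
directions. -/
def CNND.deltaQ (S : CNND) (p : Pt) (u : Pt) : ℝ :=
  bwedge (fderiv ℝ S.Gmap p u) (fderiv ℝ S.Gmap p u)

theorem mink_comm (u v : E4) : mink u v = mink v u := by simp only [mink]; ring

theorem mink_add_left (u v w : E4) : mink (u + v) w = mink u w + mink v w := by
  simp only [mink, Pi.add_apply]; ring

theorem mink_sub_left (u v w : E4) : mink (u - v) w = mink u w - mink v w := by
  simp only [mink, Pi.sub_apply]; ring

theorem mink_smul_left (c : ℝ) (u v : E4) : mink (c • u) v = c * mink u v := by
  simp only [mink, Pi.smul_apply, smul_eq_mul]; ring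

theorem mink_add_right (u v w : E4) : mink u (v + w) = mink u v + mink u w := by
  simp only [mink, Pi.add_apply]; ring

theorem mink_sub_right (u v w : E4) : mink u (v - w) = mink u v - mink u w := by
  simp only [mink, Pi.sub_apply]; ring

theorem mink_smul_right (c : ℝ) (u v : E4) : mink u (c • v) = c * mink u v := by
  simp only [mink, Pi.smul_apply, smul_eq_mul]; ring

theorem ContDiffAt.mink {n : WithTop ℕ∞} {f g : Pt → E4} {p : Pt}
    (hf : ContDiffAt ℝ n f p) (hg : ContDiffAt ℝ n g p) :
    ContDiffAt ℝ n (fun q => mink (f q) (g q)) p := by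
  rw [contDiffAt_pi] at hf hg
  exact ((((hf 0).mul (hg 0)).add ((hf 1).mul (hg 1))).add ((hf 2).mul (hg 2))).sub
    ((hf 3).mul (hg 3))

theorem fderiv_mink_apply {f g : Pt → E4} {p : Pt} (hf : DifferentiableAt ℝ f p)
    (hg : DifferentiableAt ℝ g p) (x : Pt) :
    fderiv ℝ (fun q => mink (f q) (g q)) p x =
      mink (fderiv ℝ f p x) (g p) + mink (f p) (fderiv ℝ g p x) := by
  have hf' := hasFDerivAt_pi'.1 hf.hasFDerivAt
  have hg' := hasFDerivAt_pi'.1 hg.hasFDerivAt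
  have h := (((((hf' 0).mul (hg' 0)).add ((hf' 1).mul (hg' 1))).add ((hf' 2).mul (hg' 2))).sub
    ((hf' 3).mul (hg' 3))).fderiv
  have e : (fun q => mink (f q) (g q)) =
      ((((fun q => f q 0) * fun q => g q 0) + (fun q => f q 1) * fun q => g q 1) +
        (fun q => f q 2) * fun q => g q 2) - (fun q => f q 3) * fun q => g q 3 := rfl
  rw [e, h]
  simp [mink]
  ring

/-- Leibniz rule when the Minkowski product is locally constant. -/
theorem mink_fderiv_add_eq_zero {f g : Pt → E4} {p : Pt} {c : ℝ} (hf : DifferentiableAt ℝ f p)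
    (hg : DifferentiableAt ℝ g p) (h : ∀ᶠ q in nhds p, mink (f q) (g q) = c) (x : Pt) :
    mink (fderiv ℝ f p x) (g p) + mink (f p) (fderiv ℝ g p x) = 0 := by
  rw [← fderiv_mink_apply hf hg, Filter.EventuallyEq.fderiv_eq (f := fun _ => c) h]
  simp

theorem ContDiffAt.dflat {V : Pt → E4} {X : Pt → Pt} {p : Pt}
    (hV : ContDiffAt ℝ (⊤ : ℕ∞) V p) (hX : ContDiffAt ℝ (⊤ : ℕ∞) X p) :
    ContDiffAt ℝ (⊤ : ℕ∞) (Dflat X V) p :=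
  (hV.fderiv_right (m := (⊤ : ℕ∞)) (by simp)).clm_apply hX

/-- The flat connection has no curvature; applied to an immersion, this is also the
vanishing of its torsion. -/
theorem dflat_dflat_sub_dflat_dflat {V : Pt → E4} {X Y : Pt → Pt} {p : Pt}
    (hV : ContDiffAt ℝ (⊤ : ℕ∞) V p) (hX : DifferentiableAt ℝ X p)
    (hY : DifferentiableAt ℝ Y p) :
    Dflat X (Dflat Y V) p - Dflat Y (Dflat X V) p = Dflat (lieB X Y) V p := by
  have hV' : DifferentiableAt ℝ (fderiv ℝ V) p :=
    (hV.fderiv_right (m := (⊤ : ℕ∞)) (by simp)).differentiableAt (by simp)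
  have key : ∀ Y : Pt → Pt, DifferentiableAt ℝ Y p → ∀ x, fderiv ℝ (Dflat Y V) p x =
      fderiv ℝ V p (fderiv ℝ Y p x) + fderiv ℝ (fderiv ℝ V) p x (Y p) := by
    intro Y hY x
    have h := (hV'.hasFDerivAt.clm_apply hY.hasFDerivAt).fderiv
    unfold Dflat
    rw [h]
    rfl
  have hsymm : IsSymmSndFDerivAt ℝ V p := hV.isSymmSndFDerivAt (by
    rw [minSmoothness_of_isRCLikeNormedField]
    exact WithTop.coe_le_coe.2 le_top)
  have hs := hsymm (X p) (Y p)
  change fderiv ℝ (Dflat Y V) p (X p) - fderiv ℝ (Dflat X V) p (Y p) = fderiv ℝ V p (lieB X Y p)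
  rw [key Y hY, key X hX, lieB, map_sub, hs]
  abel

theorem isNormalV.add {ψ : Pt → E4} {p : Pt} {v w : E4} (hv : isNormalV ψ p v)
    (hw : isNormalV ψ p w) : isNormalV ψ p (v + w) := fun x => by
  rw [mink_add_left, hv x, hw x, add_zero]

theorem isNormalV.sub {ψ : Pt → E4} {p : Pt} {v w : E4} (hv : isNormalV ψ p v)
    (hw : isNormalV ψ p w) : isNormalV ψ p (v - w) := fun x => by
  rw [mink_sub_left, hv x, hw x, sub_zero]

theorem isNormalV.smul {ψ : Pt → E4} {p : Pt} {v : E4} (c : ℝ) (hv : isNormalV ψ p v) :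
    isNormalV ψ p (c • v) := fun x => by
  rw [mink_smul_left, hv x, mul_zero]

namespace CNND

variable {S : CNND} {p : Pt}

theorem contDiffAt_of_contDiffOn {E : Type*} [NormedAddCommGroup E] [NormedSpace ℝ E]
    {f : Pt → E} (hf : ContDiffOn ℝ (⊤ : ℕ∞) f S.U) (hp : p ∈ S.U) :
    ContDiffAt ℝ (⊤ : ℕ∞) f p :=
  hf.contDiffAt (S.hUopen.mem_nhds hp)

theorem eventually_mem (hp : p ∈ S.U) : ∀ᶠ q in nhds p, q ∈ S.U := S.hUopen.mem_nhds hp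

theorem contDiffAt_vecF {X : Pt → Pt} (hX : ContDiffOn ℝ (⊤ : ℕ∞) X S.U) (hp : p ∈ S.U) :
    ContDiffAt ℝ (⊤ : ℕ∞) (vecF S.ψ X) p :=
  (contDiffAt_of_contDiffOn S.hψ hp).dflat (contDiffAt_of_contDiffOn hX hp)

theorem differentiableAt_vecF {X : Pt → Pt} (hX : ContDiffOn ℝ (⊤ : ℕ∞) X S.U) (hp : p ∈ S.U) :
    DifferentiableAt ℝ (vecF S.ψ X) p :=
  (contDiffAt_vecF hX hp).differentiableAt (by simp)

theorem eq_zero_of_isNormalV (hp : p ∈ S.U) {u : Pt}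
    (h : isNormalV S.ψ p (fderiv ℝ S.ψ p u)) : u = 0 := by
  by_contra hu
  exact (S.hspacelike p hp u hu).ne' (h u)

/-- Tangential and normal components are unique. -/
theorem normal_unique (hp : p ∈ S.U) {v w : E4} (hv : isNormalV S.ψ p v)
    (hw : isNormalV S.ψ p w) {u : Pt} (h : v - w = fderiv ℝ S.ψ p u) : v = w := by
  have hu : u = 0 := eq_zero_of_isNormalV hp (h ▸ hv.sub hw)
  rw [hu, map_zero] at h
  exact sub_eq_zero.1 h

theorem conn_eq_of_isNormalV (hp : p ∈ S.U) {X Y : Pt → Pt} {u : Pt}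
    (hY : DifferentiableAt ℝ (vecF S.ψ Y) p)
    (h : isNormalV S.ψ p (Dflat X (vecF S.ψ Y) p - fderiv ℝ S.ψ p u)) : S.conn X Y p = u := by
  have h1 := S.hconn X Y p hp hY
  refine sub_eq_zero.1 (eq_zero_of_isNormalV hp (u := S.conn X Y p - u) ?_)
  convert h.sub h1 using 1
  simp only [sff, vecF, map_sub]
  abel

theorem nconn_eq_of_isNormalV (hp : p ∈ S.U) {X : Pt → Pt} {ν : Pt → E4} {v : E4} {u : Pt}
    (hν : ∀ q ∈ S.U, isNormalV S.ψ q (ν q)) (hd : DifferentiableAt ℝ ν p)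
    (hv : isNormalV S.ψ p v) (h : Dflat X ν p = v + fderiv ℝ S.ψ p u) : S.nconn X ν p = v := by
  obtain ⟨hn, w, hw⟩ := S.hnconn X ν p hp hν hd
  refine normal_unique hp hn hv (u := u - w) ?_
  rw [map_sub, hw, h]
  abel

theorem zperp_eq (q : Pt) : S.Zperp q = S.Z - vecF S.ψ S.ZT q := rfl

theorem differentiableAt_zperp (hp : p ∈ S.U) : DifferentiableAt ℝ S.Zperp p :=
  (differentiableAt_vecF S.hZTsmooth hp).const_sub S.Z

theorem fderiv_zperp (x : Pt) :
    fderiv ℝ S.Zperp p x = -fderiv ℝ (vecF S.ψ S.ZT) p x := by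
  have : S.Zperp = fun q => S.Z - vecF S.ψ S.ZT q := rfl
  rw [this, fderiv_const_sub]
  rfl

theorem mink_zt_zt (hp : p ∈ S.U) : mink (vecF S.ψ S.ZT p) (vecF S.ψ S.ZT p) = 1 := by
  have h1 := S.hZunit
  have h2 := S.hZperpNull p hp
  have h3 := S.hZTtangentpart p hp (S.ZT p)
  simp only [vecF]
  simp only [mink_sub_left, mink_sub_right] at h2 h3
  have h4 := mink_comm S.Z (fderiv ℝ S.ψ p (S.ZT p))
  linarith

/-- `(Z^⊤, W)` is an orthonormal frame. -/
theorem eq_frame (hp : p ∈ S.U) (u : Pt) :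
    u = mink (fderiv ℝ S.ψ p u) (vecF S.ψ S.ZT p) • S.ZT p +
      mink (fderiv ℝ S.ψ p u) (vecF S.ψ S.Wc p) • S.Wc p := by
  obtain ⟨α, β, h⟩ : ∃ α β : ℝ, u = α • S.ZT p + β • S.Wc p := by
    have hd := (S.hWorient p hp).ne'
    refine ⟨(u.1 * (S.Wc p).2 - u.2 * (S.Wc p).1) /
        ((S.ZT p).1 * (S.Wc p).2 - (S.ZT p).2 * (S.Wc p).1),
      ((S.ZT p).1 * u.2 - (S.ZT p).2 * u.1) /
        ((S.ZT p).1 * (S.Wc p).2 - (S.ZT p).2 * (S.Wc p).1), ?_⟩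
    ext
    · rw [Prod.fst_add, Prod.smul_fst, Prod.smul_fst, smul_eq_mul, smul_eq_mul,
        div_mul_eq_mul_div, div_mul_eq_mul_div, ← add_div, eq_div_iff hd]
      ring
    · rw [Prod.snd_add, Prod.smul_snd, Prod.smul_snd, smul_eq_mul, smul_eq_mul,
        div_mul_eq_mul_div, div_mul_eq_mul_div, ← add_div, eq_div_iff hd]
      ring
  have h1 := mink_zt_zt hp
  have h2 := S.hWunit p hp
  have h3 := S.hWorth p hp
  have h4 := mink_comm (fderiv ℝ S.ψ p (S.ZT p)) (fderiv ℝ S.ψ p (S.Wc p))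
  simp only [vecF] at h1 ⊢
  rw [h]
  simp only [map_add, map_smul, mink_add_left, mink_smul_left, h1, h2, h3, ← h4, mul_one,
    mul_zero, add_zero, zero_add]

theorem isNormalV_of_frame (hp : p ∈ S.U) {v : E4} (h1 : mink v (vecF S.ψ S.ZT p) = 0)
    (h2 : mink v (vecF S.ψ S.Wc p) = 0) : isNormalV S.ψ p v := fun x => by
  simp only [vecF] at h1 h2
  rw [eq_frame hp x, map_add, map_smul, map_smul, mink_add_right, mink_smul_right,
    mink_smul_right, h1, h2, mul_zero, mul_zero, add_zero]

theorem mink_dflat_zt_zt (hp : p ∈ S.U) (X : Pt → Pt) :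
    mink (Dflat X (vecF S.ψ S.ZT) p) (vecF S.ψ S.ZT p) = 0 := by
  have hd := differentiableAt_vecF S.hZTsmooth hp
  have h := mink_fderiv_add_eq_zero hd hd ((eventually_mem hp).mono fun q hq => mink_zt_zt hq) (X p)
  rw [mink_comm (vecF S.ψ S.ZT p)] at h
  simp only [Dflat]
  linarith

theorem mink_dflat_wc_wc (hp : p ∈ S.U) (X : Pt → Pt) :
    mink (Dflat X (vecF S.ψ S.Wc) p) (vecF S.ψ S.Wc p) = 0 := by
  have hd := differentiableAt_vecF S.hWsmooth hp
  have h := mink_fderiv_add_eq_zero hd hd ((eventually_mem hp).mono fun q hq => S.hWunit q hq) (X p)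
  rw [mink_comm (vecF S.ψ S.Wc p)] at h
  simp only [Dflat]
  linarith

theorem mink_dflat_zt_wc (hp : p ∈ S.U) (X : Pt → Pt) :
    mink (Dflat X (vecF S.ψ S.ZT) p) (vecF S.ψ S.Wc p) =
      mink (Dflat X (vecF S.ψ S.Wc) p) (S.Zperp p) := by
  have h := mink_fderiv_add_eq_zero (differentiableAt_zperp hp)
    (differentiableAt_vecF S.hWsmooth hp)
    ((eventually_mem hp).mono fun q hq => S.hZTtangentpart q hq (S.Wc q)) (X p)
  rw [fderiv_zperp, mink_comm (S.Zperp p), ← zero_sub (fderiv ℝ (vecF S.ψ S.ZT) p (X p)),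
    mink_sub_left] at h
  have h0 : mink 0 (vecF S.ψ S.Wc p) = 0 := by simp [mink]
  simp only [Dflat]
  linarith

theorem mink_dflat_wc_zt (hp : p ∈ S.U) (X : Pt → Pt) :
    mink (Dflat X (vecF S.ψ S.Wc) p) (vecF S.ψ S.ZT p) =
      -mink (Dflat X (vecF S.ψ S.ZT) p) (vecF S.ψ S.Wc p) := by
  have h := mink_fderiv_add_eq_zero (differentiableAt_vecF S.hZTsmooth hp)
    (differentiableAt_vecF S.hWsmooth hp)
    ((eventually_mem hp).mono fun q hq => S.hWorth q hq) (X p)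
  rw [mink_comm (vecF S.ψ S.ZT p)] at h
  simp only [Dflat]
  linarith

theorem mink_vecF_zperp (hp : p ∈ S.U) (X : Pt → Pt) :
    mink (vecF S.ψ X p) (S.Zperp p) = 0 := by
  rw [mink_comm]
  exact S.hZTtangentpart p hp (X p)

theorem mink_dflat_zt_zperp (hp : p ∈ S.U) (X : Pt → Pt) :
    mink (Dflat X (vecF S.ψ S.ZT) p) (S.Zperp p) = 0 := by
  have hd := differentiableAt_zperp hp
  have h := mink_fderiv_add_eq_zero hd hd
    ((eventually_mem hp).mono fun q hq => S.hZperpNull q hq) (X p)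
  rw [mink_comm (S.Zperp p), fderiv_zperp, ← zero_sub (fderiv ℝ (vecF S.ψ S.ZT) p (X p)),
    mink_sub_left] at h
  have h0 : mink 0 (S.Zperp p) = 0 := by simp [mink]
  simp only [Dflat]
  linarith

theorem afun_eq (hp : p ∈ S.U) :
    S.afun p = mink (Dflat S.Wc (vecF S.ψ S.ZT) p) (vecF S.ψ S.Wc p) := by
  rw [mink_dflat_zt_wc hp, afun, B, sff, mink_sub_left, mink_vecF_zperp hp, sub_zero]

theorem differentiableAt_afun (hp : p ∈ S.U) : DifferentiableAt ℝ S.afun p := by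
  have h := ((contDiffAt_vecF S.hZTsmooth hp).dflat
    (contDiffAt_of_contDiffOn S.hWsmooth hp)).mink (contDiffAt_vecF S.hWsmooth hp)
  exact (h.differentiableAt (by simp)).congr_of_eventuallyEq
    ((eventually_mem hp).mono fun q hq => afun_eq hq)

theorem dflat_sub_dflat (hp : p ∈ S.U) :
    Dflat S.ZT (vecF S.ψ S.Wc) p - Dflat S.Wc (vecF S.ψ S.ZT) p =
      fderiv ℝ S.ψ p (lieB S.ZT S.Wc p) :=
  dflat_dflat_sub_dflat_dflat (contDiffAt_of_contDiffOn S.hψ hp)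
    ((contDiffAt_of_contDiffOn S.hZTsmooth hp).differentiableAt (by simp))
    ((contDiffAt_of_contDiffOn S.hWsmooth hp).differentiableAt (by simp))

theorem mink_dflat_zt_zt_wc (hp : p ∈ S.U) :
    mink (Dflat S.ZT (vecF S.ψ S.ZT) p) (vecF S.ψ S.Wc p) = 0 := by
  have h := congrArg (fun v => mink v (S.Zperp p)) (dflat_sub_dflat hp)
  simp only [mink_sub_left] at h
  rw [mink_dflat_zt_zperp hp, mink_comm (fderiv ℝ S.ψ p _),
    show mink (S.Zperp p) (fderiv ℝ S.ψ p (lieB S.ZT S.Wc p)) = 0 from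
      S.hZTtangentpart p hp _] at h
  rw [mink_dflat_zt_wc hp]
  linarith

theorem isNormalV_dflat_zt_zt (hp : p ∈ S.U) : isNormalV S.ψ p (Dflat S.ZT (vecF S.ψ S.ZT) p) :=
  isNormalV_of_frame hp (mink_dflat_zt_zt hp _) (mink_dflat_zt_zt_wc hp)

theorem isNormalV_dflat_zt_wc (hp : p ∈ S.U) : isNormalV S.ψ p (Dflat S.ZT (vecF S.ψ S.Wc) p) :=
  isNormalV_of_frame hp (by rw [mink_dflat_wc_zt hp, mink_dflat_zt_zt_wc hp, neg_zero])
    (mink_dflat_wc_wc hp _)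

theorem isNormalV_dflat_wc_zt (hp : p ∈ S.U) :
    isNormalV S.ψ p (Dflat S.Wc (vecF S.ψ S.ZT) p - S.afun p • vecF S.ψ S.Wc p) := by
  have h1 : mink (vecF S.ψ S.Wc p) (vecF S.ψ S.Wc p) = 1 := S.hWunit p hp
  have h2 : mink (vecF S.ψ S.ZT p) (vecF S.ψ S.Wc p) = 0 := S.hWorth p hp
  refine isNormalV_of_frame hp ?_ ?_
  · rw [mink_sub_left, mink_smul_left, mink_dflat_zt_zt hp, mink_comm (vecF S.ψ S.Wc p), h2]
    simp
  · rw [mink_sub_left, mink_smul_left, ← afun_eq hp, h1]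
    simp

theorem conn_zt_zt (hp : p ∈ S.U) : S.conn S.ZT S.ZT p = 0 :=
  conn_eq_of_isNormalV hp (differentiableAt_vecF S.hZTsmooth hp)
    (by simpa using isNormalV_dflat_zt_zt hp)

theorem conn_zt_wc (hp : p ∈ S.U) : S.conn S.ZT S.Wc p = 0 :=
  conn_eq_of_isNormalV hp (differentiableAt_vecF S.hWsmooth hp)
    (by simpa using isNormalV_dflat_zt_wc hp)

theorem conn_wc_zt (hp : p ∈ S.U) : S.conn S.Wc S.ZT p = S.afun p • S.Wc p :=
  conn_eq_of_isNormalV hp (differentiableAt_vecF S.hZTsmooth hp)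
    (by simpa [vecF] using isNormalV_dflat_wc_zt hp)

theorem B_zt_wc (hp : p ∈ S.U) : S.B S.ZT S.Wc p = Dflat S.ZT (vecF S.ψ S.Wc) p := by
  simp [B, sff, vecF, conn_zt_wc hp]

/-- Symmetry of the second fundamental form on the frame. -/
theorem dflat_wc_zt_eq (hp : p ∈ S.U) :
    Dflat S.Wc (vecF S.ψ S.ZT) p = S.B S.ZT S.Wc p + S.afun p • vecF S.ψ S.Wc p := by
  rw [B_zt_wc hp, ← sub_eq_iff_eq_add]
  refine (normal_unique hp (isNormalV_dflat_zt_wc hp) (isNormalV_dflat_wc_zt hp)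
    (u := lieB S.ZT S.Wc p + S.afun p • S.Wc p) ?_).symm
  rw [map_add, map_smul, ← dflat_sub_dflat hp]
  simp only [vecF]
  abel

theorem lieB_zt_wc (hp : p ∈ S.U) : lieB S.ZT S.Wc p = -(S.afun p) • S.Wc p := by
  refine sub_eq_zero.1 (eq_zero_of_isNormalV hp ?_)
  rw [map_sub, map_smul, ← dflat_sub_dflat hp, dflat_wc_zt_eq hp, B_zt_wc hp]
  intro x
  simp [vecF, mink]

theorem dflat_lieB_zt (hp : p ∈ S.U) :
    Dflat (lieB S.ZT S.Wc) (vecF S.ψ S.ZT) p =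
      -(S.afun p) • (S.B S.ZT S.Wc p + S.afun p • vecF S.ψ S.Wc p) := by
  rw [← dflat_wc_zt_eq hp]
  simp only [Dflat]
  rw [lieB_zt_wc hp, map_smul]

theorem isNormalV_B_zt_wc (hp : p ∈ S.U) : isNormalV S.ψ p (S.B S.ZT S.Wc p) :=
  B_zt_wc hp ▸ isNormalV_dflat_zt_wc hp

theorem dflat_afun_smul_wc (hp : p ∈ S.U) :
    Dflat S.ZT (fun q => S.afun q • vecF S.ψ S.Wc q) p =
      S.afun p • S.B S.ZT S.Wc p + fderiv ℝ S.afun p (S.ZT p) • vecF S.ψ S.Wc p := by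
  rw [B_zt_wc hp]
  simp only [Dflat]
  rw [fderiv_fun_smul (differentiableAt_afun hp) (differentiableAt_vecF S.hWsmooth hp)]
  simp

theorem curvR_zt_wc_zt (hp : p ∈ S.U) :
    curvR S.conn S.ZT S.Wc S.ZT p =
      (-(fderiv ℝ S.afun p (S.ZT p)) - S.afun p ^ 2) • S.Wc p := by
  have e1 : vecF S.ψ (S.conn S.ZT S.ZT) =ᶠ[nhds p] fun _ => 0 :=
    (eventually_mem hp).mono fun q hq => by simp [vecF, conn_zt_zt hq]
  have e2 : vecF S.ψ (S.conn S.Wc S.ZT) =ᶠ[nhds p] fun q => S.afun q • vecF S.ψ S.Wc q :=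
    (eventually_mem hp).mono fun q hq => by simp [vecF, conn_wc_zt hq]
  have c1 : S.conn S.Wc (S.conn S.ZT S.ZT) p = 0 := by
    refine conn_eq_of_isNormalV hp
      ((differentiableAt_const (0 : E4)).congr_of_eventuallyEq e1) fun x => ?_
    rw [Dflat, e1.fderiv_eq]
    simp [mink]
  have c2 : S.conn S.ZT (S.conn S.Wc S.ZT) p = fderiv ℝ S.afun p (S.ZT p) • S.Wc p := by
    refine conn_eq_of_isNormalV hp (((differentiableAt_afun hp).fun_smul
      (differentiableAt_vecF S.hWsmooth hp)).congr_of_eventuallyEq e2) ?_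
    have h := dflat_afun_smul_wc hp
    rw [Dflat] at h ⊢
    rw [e2.fderiv_eq, h, map_smul]
    simpa [vecF] using (isNormalV_B_zt_wc hp).smul (S.afun p)
  have c3 : S.conn (lieB S.ZT S.Wc) S.ZT p = -(S.afun p ^ 2) • S.Wc p := by
    refine conn_eq_of_isNormalV hp (differentiableAt_vecF S.hZTsmooth hp) ?_
    convert (isNormalV_B_zt_wc hp).smul (-S.afun p) using 1
    rw [dflat_lieB_zt hp, map_smul]
    simp only [vecF]
    module
  rw [curvR, c1, c2, c3]
  module

theorem isNormalV_zperp (q : Pt) (hq : q ∈ S.U) : isNormalV S.ψ q (S.Zperp q) :=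
  S.hZTtangentpart q hq

theorem nconn_zt_zperp (hp : p ∈ S.U) :
    S.nconn S.ZT S.Zperp p = -Dflat S.ZT (vecF S.ψ S.ZT) p := by
  refine nconn_eq_of_isNormalV hp isNormalV_zperp (differentiableAt_zperp hp) (u := 0) ?_ ?_
  · simpa using (isNormalV_dflat_zt_zt hp).smul (-1)
  · simp [Dflat, fderiv_zperp]

theorem nconn_wc_zperp (hp : p ∈ S.U) :
    S.nconn S.Wc S.Zperp p =
      S.afun p • vecF S.ψ S.Wc p - Dflat S.Wc (vecF S.ψ S.ZT) p := by
  refine nconn_eq_of_isNormalV hp isNormalV_zperp (differentiableAt_zperp hp)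
    (u := -(S.afun p • S.Wc p)) ?_ ?_
  · simpa using (isNormalV_dflat_wc_zt hp).smul (-1)
  · simp only [Dflat, fderiv_zperp, vecF, map_neg, map_smul]
    abel

theorem nconn_lieB_zperp (hp : p ∈ S.U) :
    S.nconn (lieB S.ZT S.Wc) S.Zperp p = S.afun p • S.B S.ZT S.Wc p := by
  refine nconn_eq_of_isNormalV hp isNormalV_zperp (differentiableAt_zperp hp)
    (u := S.afun p ^ 2 • S.Wc p) ((isNormalV_B_zt_wc hp).smul _) ?_
  have h := dflat_lieB_zt hp
  rw [Dflat] at h ⊢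
  rw [fderiv_zperp, h, map_smul]
  simp only [vecF]
  module

theorem curvRperp_zt_wc_zperp (hp : p ∈ S.U) :
    curvRperp S.nconn S.ZT S.Wc S.Zperp p = (-S.afun p) • S.B S.ZT S.Wc p := by
  have hT := contDiffAt_vecF S.hZTsmooth hp
  have d1 : DifferentiableAt ℝ (Dflat S.ZT (vecF S.ψ S.ZT)) p :=
    (hT.dflat (contDiffAt_of_contDiffOn S.hZTsmooth hp)).differentiableAt (by simp)
  have d2 : DifferentiableAt ℝ (Dflat S.Wc (vecF S.ψ S.ZT)) p :=
    (hT.dflat (contDiffAt_of_contDiffOn S.hWsmooth hp)).differentiableAt (by simp)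
  have d3 : DifferentiableAt ℝ (fun q => S.afun q • vecF S.ψ S.Wc q) p :=
    (differentiableAt_afun hp).fun_smul (differentiableAt_vecF S.hWsmooth hp)
  have e1 : S.nconn S.ZT S.Zperp =ᶠ[nhds p] fun q => -Dflat S.ZT (vecF S.ψ S.ZT) q :=
    (eventually_mem hp).mono fun q hq => nconn_zt_zperp hq
  have e2 : S.nconn S.Wc S.Zperp =ᶠ[nhds p] fun q =>
      S.afun q • vecF S.ψ S.Wc q - Dflat S.Wc (vecF S.ψ S.ZT) q :=
    (eventually_mem hp).mono fun q hq => nconn_wc_zperp hq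
  have n : ∀ X, ∀ q ∈ S.U, isNormalV S.ψ q (S.nconn X S.Zperp q) := fun X q hq =>
    (S.hnconn X S.Zperp q hq isNormalV_zperp (differentiableAt_zperp hq)).1
  obtain ⟨n1, u1, h1⟩ := S.hnconn S.Wc _ p hp (n S.ZT) (d1.fun_neg.congr_of_eventuallyEq e1)
  obtain ⟨n2, u2, h2⟩ := S.hnconn S.ZT _ p hp (n S.Wc) ((d3.fun_sub d2).congr_of_eventuallyEq e2)
  have flat := dflat_dflat_sub_dflat_dflat hT
    ((contDiffAt_of_contDiffOn S.hZTsmooth hp).differentiableAt (by simp))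
    ((contDiffAt_of_contDiffOn S.hWsmooth hp).differentiableAt (by simp))
  rw [dflat_lieB_zt hp] at flat
  have f1 : Dflat S.Wc (S.nconn S.ZT S.Zperp) p =
      -Dflat S.Wc (Dflat S.ZT (vecF S.ψ S.ZT)) p := by
    rw [Dflat, e1.fderiv_eq, fderiv_fun_neg]
    rfl
  have f2 : Dflat S.ZT (S.nconn S.Wc S.Zperp) p =
      Dflat S.ZT (fun q => S.afun q • vecF S.ψ S.Wc q) p -
        Dflat S.ZT (Dflat S.Wc (vecF S.ψ S.ZT)) p := by
    rw [Dflat, e2.fderiv_eq, fderiv_fun_sub d3 d2]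
    rfl
  rw [dflat_afun_smul_wc hp] at f2
  rw [f1] at h1
  rw [f2] at h2
  rw [curvRperp, nconn_lieB_zperp hp]
  refine normal_unique hp ((n1.sub n2).add ((isNormalV_B_zt_wc hp).smul _))
    ((isNormalV_B_zt_wc hp).smul _)
    (u := u2 - u1 - (fderiv ℝ S.afun p (S.ZT p) + S.afun p ^ 2) • S.Wc p) ?_
  rw [map_sub, map_sub, h1, h2, map_smul]
  rw [sub_eq_iff_eq_add] at flat
  rw [flat]
  simp only [vecF]
  module

end CNND

/-- The curvature tensor `R` of `M` and the normal curvature tensor `R^⊥`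
satisfy `R(Z^⊤,W)Z^⊤ = (−Z^⊤(a) − a²) W` and `R^⊥(Z^⊤,W)Z^⊥ = −a B(Z^⊤,W)`. -/
theorem cnnd_curvature_tensors (S : CNND) :
    ∀ p ∈ S.U,
      fderiv ℝ S.ψ p (curvR S.conn S.ZT S.Wc S.ZT p) =
        (-(fderiv ℝ S.afun p (S.ZT p)) - S.afun p ^ 2) • fderiv ℝ S.ψ p (S.Wc p) ∧
      curvRperp S.nconn S.ZT S.Wc S.Zperp p = (-S.afun p) • S.B S.ZT S.Wc p := by
  intro p hp
  exact ⟨by rw [CNND.curvR_zt_wc_zt hp, map_smul], CNND.curvRperp_zt_wc_zperp hp⟩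

end
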